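/- Let F_q be a finite field with q elements, k ≥ 2 a fixed integer, and ω_k(f) the number of monic irreducible factors of f with multiplicity exactly k. As n → ∞, Σ_{f ∈ M_n} ω_k(f)² = c_k' q^n + O(n · q^{n/k}), where c_k' = (L(k) - L(k+1))(L(k) - L(k+1) + 1) - L(2k) + 2L(2k+1) - L(2k+2). -/

import Mathlib

open Filter Asymptotics Real Polynomial

/-- number of monic irreducible polynomials of degree r in F[t] -/
noncomputable def piq (F : Type*) [Field F] [Fintype F] (r : ℕ) : ℕ :=
  Nat.card {l : Polynomial F // l.Monic ∧ Irreducible l ∧ l.natDegree = r}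

/-- the constant A₁ = γ + Σ_{r≥1} (π_q(r) - q^r/r) q^{-r} -/
noncomputable def A1 (F : Type*) [Field F] [Fintype F] : ℝ :=
  Real.eulerMascheroniConstant +
    ∑' r : ℕ, if r = 0 then 0 else
      ((piq F r : ℝ) - (Fintype.card F : ℝ) ^ r / r) * ((Fintype.card F : ℝ) ^ r)⁻¹

/-- L(m) = Σ_{l ∈ P} |l|^{-m} -/
noncomputable def Lc (F : Type*) [Field F] [Fintype F] (m : ℕ) : ℝ :=
  ∑' l : {l : Polynomial F // l.Monic ∧ Irreducible l},
    (((Fintype.card F : ℝ) ^ (l : Polynomial F).natDegree) ^ m)⁻¹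

/-- ω_k(f): the number of distinct monic irreducible factors of f with multiplicity exactly k -/
noncomputable def omegak (F : Type*) [Field F] [Fintype F] (k : ℕ) (f : Polynomial F) : ℕ :=
  Nat.card {l : Polynomial F // l.Monic ∧ Irreducible l ∧ l ^ k ∣ f ∧ ¬ l ^ (k + 1) ∣ f}


section aux
open Finset

lemma sum_by_degree {ι : Type*} (deg : ι → ℕ) (c : ℕ → ℝ) (g : ℕ → ℝ) (hg : ∀ d, 0 ≤ g d)
    (hc : ∀ d, ∀ u : Finset ι, (∀ i ∈ u, deg i = d) → (#u : ℝ) ≤ c d)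
    (hs : Summable fun d => c d * g d) :
    Summable (fun i => g (deg i)) ∧ ∑' i, g (deg i) ≤ ∑' d, c d * g d := by
  classical
  have hc0 : ∀ d, 0 ≤ c d := fun d => by simpa using hc d ∅ (by simp)
  have key : ∀ u : Finset ι, ∑ i ∈ u, g (deg i) ≤ ∑' d, c d * g d := by
    intro u
    rw [Finset.sum_comp]
    refine le_trans (Finset.sum_le_sum (g := fun d => c d * g d) ?_)
      (hs.sum_le_tsum _ (fun d _ => mul_nonneg (hc0 d) (hg d)))
    intro d _
    rw [nsmul_eq_mul]
    exact mul_le_mul_of_nonneg_right (hc d _ (by simp)) (hg d)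
  have h0 : 0 ≤ fun i => g (deg i) := fun i => hg _
  exact ⟨summable_of_sum_le h0 key, Real.tsum_le_of_sum_le h0 key⟩

noncomputable def Keps : ℝ := 2 + ∑' j : ℕ, ((j : ℝ) + 2) * (1 / 2) ^ j

lemma summable_K : Summable (fun j : ℕ => ((j : ℝ) + 2) * (1 / 2 : ℝ) ^ j) := by
  have h1 : Summable (fun j : ℕ => (j : ℝ) ^ 1 * (1 / 2 : ℝ) ^ j) :=
    summable_pow_mul_geometric_of_norm_lt_one 1 (by norm_num)
  have h2 : Summable (fun j : ℕ => (1 / 2 : ℝ) ^ j) := summable_geometric_two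
  refine (h1.add (h2.mul_left 2)).congr fun j => by ring

lemma Keps_nonneg : 0 ≤ Keps := by
  unfold Keps
  have : 0 ≤ ∑' j : ℕ, ((j : ℝ) + 2) * (1 / 2 : ℝ) ^ j := tsum_nonneg fun j => by positivity
  linarith

lemma eps_sum (q : ℝ) (hq : 2 ≤ q) (k : ℕ) (hk : 2 ≤ k) (n : ℕ) :
    Summable (fun s : ℕ => (((s : ℝ) + 1) * q ^ s) * min 1 (q ^ n / q ^ (k * s))) ∧
    ∑' s : ℕ, (((s : ℝ) + 1) * q ^ s) * min 1 (q ^ n / q ^ (k * s)) ≤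
      Keps * (((n / k : ℕ) : ℝ) + 1) * q ^ (n / k) := by
  set m := n / k with hm
  have hq0 : 0 < q := by linarith
  have hnm : n + 1 ≤ k * (m + 1) := by
    have := Nat.lt_mul_div_succ n (show 0 < k by omega)
    simpa [hm] using this
  set f : ℕ → ℝ := fun s : ℕ => (((s : ℝ) + 1) * q ^ s) * min 1 (q ^ n / q ^ (k * s)) with hf
  have hf0 : ∀ s, 0 ≤ f s := fun s => by simp only [hf]; positivity
  have htail : ∀ j, f (j + (m + 1)) ≤ ((m : ℝ) + 1) * q ^ m * (((j : ℝ) + 2) * (1 / 2) ^ j) := by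
    intro j
    have h1 : f (j + (m + 1)) ≤ ((((j + (m + 1) : ℕ) : ℝ) + 1) * q ^ (j + (m + 1))) *
        (q ^ n / q ^ (k * (j + (m + 1)))) := by
      simp only [hf]
      gcongr
      exact min_le_right _ _
    have h2 : q ^ (j + (m + 1)) * (q ^ n / q ^ (k * (j + (m + 1)))) ≤ q ^ m * (1 / 2) ^ j := by
      have h3 : q ^ (j + (m + 1)) * q ^ n * q ^ j ≤ q ^ m * q ^ (k * (j + (m + 1))) := by
        rw [← pow_add, ← pow_add, ← pow_add]
        apply pow_le_pow_right₀ (by linarith)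
        have : 2 * j ≤ k * j := Nat.mul_le_mul_right _ hk
        nlinarith
      have h4 : q ^ (j + (m + 1)) * (q ^ n / q ^ (k * (j + (m + 1)))) ≤ q ^ m * (1 / q) ^ j := by
        rw [one_div, inv_pow, ← div_eq_mul_inv, mul_div_assoc', div_le_div_iff₀ (by positivity) (by positivity)]
        exact h3
      refine h4.trans ?_
      gcongr
    have h5 : (((j + (m + 1) : ℕ) : ℝ) + 1) ≤ ((m : ℝ) + 1) * ((j : ℝ) + 2) := by
      push_cast
      have : (0:ℝ) ≤ m * j := by positivity
      have : (0:ℝ) ≤ m := by positivity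
      nlinarith
    calc f (j + (m + 1)) ≤ (((j + (m + 1) : ℕ) : ℝ) + 1) *
          (q ^ (j + (m + 1)) * (q ^ n / q ^ (k * (j + (m + 1))))) := by rw [← mul_assoc]; exact h1
      _ ≤ (((m : ℝ) + 1) * ((j : ℝ) + 2)) * (q ^ m * (1 / 2) ^ j) := by gcongr
      _ = _ := by ring
  have hst : Summable (fun j => f (j + (m + 1))) :=
    Summable.of_nonneg_of_le (fun j => hf0 _) htail (summable_K.mul_left _)
  have hs : Summable f := (summable_nat_add_iff (m + 1)).1 hst
  refine ⟨hs, ?_⟩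
  rw [← hs.sum_add_tsum_nat_add (m + 1)]
  have hA : ∑ i ∈ range (m + 1), f i ≤ ((m : ℝ) + 1) * (2 * q ^ m) := by
    have h1 : ∀ i ∈ range (m + 1), f i ≤ ((m : ℝ) + 1) * q ^ i := by
      intro i hi
      have him : (i : ℝ) ≤ m := by exact_mod_cast Nat.lt_succ_iff.1 (Finset.mem_range.1 hi)
      calc f i ≤ (((i : ℝ) + 1) * q ^ i) * 1 := by
            simp only [hf]; gcongr; exact min_le_left _ _
        _ ≤ _ := by rw [mul_one]; gcongr
    refine (Finset.sum_le_sum h1).trans ?_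
    rw [← Finset.mul_sum]
    gcongr
    rw [geom_sum_eq (by linarith), div_le_iff₀ (by linarith), pow_succ]
    have : 0 < q ^ m := by positivity
    nlinarith
  have hB : ∑' j, f (j + (m + 1)) ≤ ((m : ℝ) + 1) * q ^ m * ∑' j : ℕ, ((j : ℝ) + 2) * (1 / 2) ^ j := by
    rw [← tsum_mul_left]
    exact hst.tsum_le_tsum htail (summable_K.mul_left _)
  unfold Keps
  calc _ ≤ _ := add_le_add hA hB
    _ = _ := by ring

section poly
variable (F : Type*) [Field F] [Fintype F]

lemma card_monic (n : ℕ) :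
    Nat.card {p : F[X] // p.Monic ∧ p.natDegree = n} = Fintype.card F ^ n := by
  rw [Nat.card_congr ((monicEquivDegreeLT n).trans (degreeLTEquiv F n).toEquiv)]
  simp

lemma finite_monic (n : ℕ) : {p : F[X] | p.Monic ∧ p.natDegree = n}.Finite := by
  have : Finite {p : F[X] // p.Monic ∧ p.natDegree = n} :=
    Finite.of_equiv _ ((monicEquivDegreeLT n).trans (degreeLTEquiv F n).toEquiv).symm
  exact Set.finite_coe_iff.1 this

noncomputable def Mn (n : ℕ) : Finset F[X] := (finite_monic F n).toFinset

variable {F}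
lemma mem_Mn {n : ℕ} {f : F[X]} : f ∈ Mn F n ↔ f.Monic ∧ f.natDegree = n := by
  simp [Mn]

variable (F)
lemma card_Mn (n : ℕ) : #(Mn F n) = Fintype.card F ^ n := by
  rw [← card_monic F n, Mn, ← Nat.card_eq_card_finite_toFinset]
  rfl

variable {F}
open Classical in
lemma card_dvd (n : ℕ) (h : F[X]) (hh : h.Monic) :
    #((Mn F n).filter (fun f => h ∣ f)) =
      if h.natDegree ≤ n then Fintype.card F ^ (n - h.natDegree) else 0 := by
  split_ifs with hd
  · rw [← card_Mn, eq_comm]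
    refine Finset.card_bij (fun g _ => h * g) ?_ ?_ ?_
    · intro g hg
      rw [mem_Mn] at hg
      rw [Finset.mem_filter, mem_Mn]
      refine ⟨⟨hh.mul hg.1, ?_⟩, dvd_mul_right _ _⟩
      rw [hh.natDegree_mul hg.1, hg.2]; omega
    · intro a _ b _ hab
      exact mul_left_cancel₀ hh.ne_zero hab
    · intro f hf
      rw [Finset.mem_filter, mem_Mn] at hf
      obtain ⟨⟨hf1, hf2⟩, g, rfl⟩ := hf
      have hg := hh.of_mul_monic_left hf1
      refine ⟨g, ?_, rfl⟩
      rw [hh.natDegree_mul hg] at hf2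
      rw [mem_Mn]
      exact ⟨hg, by omega⟩
  · rw [Finset.card_eq_zero, Finset.filter_eq_empty_iff]
    intro f hf hdvd
    rw [mem_Mn] at hf
    have := natDegree_le_of_dvd hdvd hf.1.ne_zero
    omega

/-- monic irreducibles -/
abbrev PP (F : Type*) [Field F] [Fintype F] := {l : F[X] // l.Monic ∧ Irreducible l}

lemma two_le_q : (2 : ℝ) ≤ Fintype.card F := by
  exact_mod_cast Fintype.one_lt_card (α := F)

lemma fiber1 (d : ℕ) (u : Finset (PP F)) (hu : ∀ i ∈ u, i.1.natDegree = d) :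
    (#u : ℝ) ≤ (Fintype.card F : ℝ) ^ d := by
  have : #u ≤ #(Mn F d) := by
    refine Finset.card_le_card_of_injOn (fun i => i.1) ?_ (Subtype.val_injective.injOn)
    intro i hi
    exact mem_Mn.2 ⟨i.2.1, hu i hi⟩
  rw [card_Mn] at this
  exact_mod_cast this

lemma fiber2 (d : ℕ) (u : Finset (PP F × PP F))
    (hu : ∀ i ∈ u, i.1.1.natDegree + i.2.1.natDegree = d) :
    (#u : ℝ) ≤ ((d : ℝ) + 1) * (Fintype.card F : ℝ) ^ d := by
  classical
  have h1 : #u ≤ #((antidiagonal d).biUnion fun x => Mn F x.1 ×ˢ Mn F x.2) := by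
    refine Finset.card_le_card_of_injOn (fun i => (i.1.1, i.2.1)) ?_ ?_
    · intro i hi
      simp only [Finset.coe_biUnion, Set.mem_iUnion, Finset.mem_coe, Finset.mem_product]
      exact ⟨(i.1.1.natDegree, i.2.1.natDegree), by simpa using hu i hi,
        mem_Mn.2 ⟨i.1.2.1, rfl⟩, mem_Mn.2 ⟨i.2.2.1, rfl⟩⟩
    · rintro ⟨a, b⟩ _ ⟨c, e⟩ _ h
      simp only [Prod.mk.injEq] at h
      exact Prod.ext (Subtype.ext h.1) (Subtype.ext h.2)
  have h2 : #u ≤ (d + 1) * Fintype.card F ^ d := by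
    refine h1.trans (Finset.card_biUnion_le.trans ?_)
    have : ∀ x ∈ antidiagonal d, #(Mn F x.1 ×ˢ Mn F x.2) = Fintype.card F ^ d := by
      intro x hx
      rw [Finset.card_product, card_Mn, card_Mn, ← pow_add, Finset.HasAntidiagonal.mem_antidiagonal.1 hx]
    rw [Finset.sum_congr rfl this]
    simp
  exact_mod_cast h2


open Classical in
noncomputable def dv (h f : F[X]) : ℝ := if h ∣ f then 1 else 0

open Classical in
noncomputable def ind (k : ℕ) (l f : F[X]) : ℝ := if l ^ k ∣ f ∧ ¬ l ^ (k + 1) ∣ f then 1 else 0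

lemma ind_eq (k : ℕ) (l f : F[X]) : ind k l f = dv (l ^ k) f - dv (l ^ (k + 1)) f := by
  unfold ind dv
  have : l ^ (k + 1) ∣ f → l ^ k ∣ f := fun h => (pow_dvd_pow l (Nat.le_succ k)).trans h
  by_cases h1 : l ^ (k + 1) ∣ f
  · simp [h1, this h1]
  · by_cases h2 : l ^ k ∣ f <;> simp [h1, h2]

lemma dv_mul (a b f : F[X]) (h : IsCoprime a b) : dv a f * dv b f = dv (a * b) f := by
  unfold dv
  by_cases h1 : a ∣ f
  · by_cases h2 : b ∣ f
    · simp [h1, h2, h.mul_dvd h1 h2]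
    · have : ¬ a * b ∣ f := fun h => h2 (dvd_of_mul_left_dvd h)
      simp [h2, this]
  · have : ¬ a * b ∣ f := fun h => h1 (dvd_of_mul_right_dvd h)
    simp [h1, this]

variable (F) in
noncomputable def Nn (n w : ℕ) : ℝ := if w ≤ n then (Fintype.card F : ℝ) ^ (n - w) else 0

lemma sum_dv (n : ℕ) (h : F[X]) (hh : h.Monic) : ∑ f ∈ Mn F n, dv h f = Nn F n h.natDegree := by
  classical
  unfold dv Nn
  rw [Finset.sum_boole]
  have := card_dvd n h hh
  split_ifs at this ⊢ with h1
  · rw [← Nat.cast_pow, ← this]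
  · rw [Nat.cast_eq_zero, ← this]

variable (F) in
noncomputable def eps (k n s : ℕ) : ℝ :=
  min 1 ((Fintype.card F : ℝ) ^ n / (Fintype.card F : ℝ) ^ (k * s))

lemma Nn_err (n w k s : ℕ) (hw : k * s ≤ w) :
    |Nn F n w - (Fintype.card F : ℝ) ^ n / (Fintype.card F : ℝ) ^ w| ≤ eps F k n s := by
  have hq := two_le_q (F := F)
  set q : ℝ := (Fintype.card F : ℝ)
  have hq0 : 0 < q := by linarith
  have he : 0 ≤ eps F k n s := by unfold eps; positivity
  unfold Nn
  split_ifs with h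
  · rw [pow_sub₀ _ hq0.ne' h, ← div_eq_mul_inv, sub_self, abs_zero]
    exact he
  · rw [zero_sub, abs_neg, abs_of_nonneg (by positivity)]
    refine le_min ?_ ?_
    · rw [div_le_one (by positivity)]
      exact pow_le_pow_right₀ (by linarith) (by omega)
    · change q ^ n / q ^ w ≤ q ^ n / q ^ (k * s)
      gcongr
      linarith

noncomputable def del (k : ℕ) (l : PP F) : ℝ :=
  (((Fintype.card F : ℝ) ^ l.1.natDegree) ^ k)⁻¹ -
    (((Fintype.card F : ℝ) ^ l.1.natDegree) ^ (k + 1))⁻¹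

lemma err1 (k n : ℕ) (l : PP F) :
    |∑ f ∈ Mn F n, ind k l.1 f - (Fintype.card F : ℝ) ^ n * del k l| ≤
      2 * eps F k n l.1.natDegree := by
  simp_rw [ind_eq]
  rw [Finset.sum_sub_distrib, sum_dv _ _ (l.2.1.pow _), sum_dv _ _ (l.2.1.pow _)]
  rw [natDegree_pow, natDegree_pow]
  have h1 := Nn_err (F := F) n (k * l.1.natDegree) k l.1.natDegree le_rfl
  have h2 := Nn_err (F := F) n ((k + 1) * l.1.natDegree) k l.1.natDegree (by nlinarith)
  rw [abs_le] at *
  have : (Fintype.card F : ℝ) ^ n * del k l = (Fintype.card F : ℝ) ^ n / (Fintype.card F : ℝ) ^ (k * l.1.natDegree)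
    - (Fintype.card F : ℝ) ^ n / (Fintype.card F : ℝ) ^ ((k + 1) * l.1.natDegree) := by
    unfold del
    rw [← pow_mul, ← pow_mul, mul_comm k, mul_comm (k + 1)]
    ring
  rw [this]
  constructor <;> linarith [h1.1, h1.2, h2.1, h2.2]

lemma coprime_of_ne {l₁ l₂ : PP F} (h : l₁ ≠ l₂) : IsCoprime l₁.1 l₂.1 := by
  rw [l₁.2.2.coprime_iff_not_dvd]
  intro hd
  have := l₁.2.2.associated_of_dvd l₂.2.2 hd
  exact h (Subtype.ext (eq_of_monic_of_associated l₁.2.1 l₂.2.1 this))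

lemma err2 (k n : ℕ) (l₁ l₂ : PP F) (h : l₁ ≠ l₂) :
    |∑ f ∈ Mn F n, ind k l₁.1 f * ind k l₂.1 f - (Fintype.card F : ℝ) ^ n * (del k l₁ * del k l₂)| ≤
      4 * eps F k n (l₁.1.natDegree + l₂.1.natDegree) := by
  have hco := coprime_of_ne h
  have hq := two_le_q (F := F)
  have hsum : ∀ a b : ℕ, ∑ f ∈ Mn F n, dv (l₁.1 ^ a) f * dv (l₂.1 ^ b) f =
      Nn F n (a * l₁.1.natDegree + b * l₂.1.natDegree) := by
    intro a b
    simp_rw [dv_mul _ _ _ (hco.pow (m := a) (n := b))]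
    rw [sum_dv _ _ ((l₁.2.1.pow a).mul (l₂.2.1.pow b)),
      (l₁.2.1.pow a).natDegree_mul (l₂.2.1.pow b), natDegree_pow, natDegree_pow]
  have hexp : ∑ f ∈ Mn F n, ind k l₁.1 f * ind k l₂.1 f =
      Nn F n (k * l₁.1.natDegree + k * l₂.1.natDegree) -
      Nn F n (k * l₁.1.natDegree + (k + 1) * l₂.1.natDegree) -
      Nn F n ((k + 1) * l₁.1.natDegree + k * l₂.1.natDegree) +
      Nn F n ((k + 1) * l₁.1.natDegree + (k + 1) * l₂.1.natDegree) := by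
    rw [← hsum, ← hsum, ← hsum, ← hsum, ← Finset.sum_sub_distrib, ← Finset.sum_sub_distrib,
      ← Finset.sum_add_distrib]
    refine Finset.sum_congr rfl fun f _ => ?_
    rw [ind_eq, ind_eq]; ring
  rw [hexp]
  set d₁ := l₁.1.natDegree
  set d₂ := l₂.1.natDegree
  have h1 := Nn_err (F := F) n (k * d₁ + k * d₂) k (d₁ + d₂) (by nlinarith)
  have h2 := Nn_err (F := F) n (k * d₁ + (k + 1) * d₂) k (d₁ + d₂) (by nlinarith)
  have h3 := Nn_err (F := F) n ((k + 1) * d₁ + k * d₂) k (d₁ + d₂) (by nlinarith)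
  have h4 := Nn_err (F := F) n ((k + 1) * d₁ + (k + 1) * d₂) k (d₁ + d₂) (by nlinarith)
  have hm : (Fintype.card F : ℝ) ^ n * (del k l₁ * del k l₂) =
      (Fintype.card F : ℝ) ^ n / (Fintype.card F : ℝ) ^ (k * d₁ + k * d₂) -
      (Fintype.card F : ℝ) ^ n / (Fintype.card F : ℝ) ^ (k * d₁ + (k + 1) * d₂) -
      (Fintype.card F : ℝ) ^ n / (Fintype.card F : ℝ) ^ ((k + 1) * d₁ + k * d₂) +
      (Fintype.card F : ℝ) ^ n / (Fintype.card F : ℝ) ^ ((k + 1) * d₁ + (k + 1) * d₂) := by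
    unfold del
    rw [← pow_mul, ← pow_mul, mul_comm _ k, mul_comm _ (k + 1), ← pow_mul, ← pow_mul, mul_comm _ k,
      mul_comm _ (k + 1)]
    simp only [pow_add _ (_ * _) (_ * _), div_eq_mul_inv, mul_inv]
    ring
  rw [hm]
  rw [abs_le] at *
  constructor <;> linarith [h1.1, h1.2, h2.1, h2.2, h3.1, h3.2, h4.1, h4.2]

variable (F) in
lemma finite_T (n : ℕ) : {l : PP F | l.1.natDegree ≤ n}.Finite := by
  have : ((⋃ d ∈ Set.Iic n, {p : F[X] | p.Monic ∧ p.natDegree = d})).Finite :=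
    (Set.finite_Iic n).biUnion fun d _ => finite_monic F d
  refine Set.Finite.of_injOn (f := Subtype.val) ?_ Subtype.val_injective.injOn this
  intro l hl
  simp only [Set.mem_iUnion]
  exact ⟨_, hl, l.2.1, rfl⟩

variable (F) in
noncomputable def Tn (n : ℕ) : Finset (PP F) := (finite_T F n).toFinset

lemma mem_Tn {n : ℕ} {l : PP F} : l ∈ Tn F n ↔ l.1.natDegree ≤ n := by simp [Tn]

lemma ind_zero {k n : ℕ} (hk : 2 ≤ k) {l : PP F} {f : F[X]} (hf : f ∈ Mn F n) (hl : l ∉ Tn F n) :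
    ind k l.1 f = 0 := by
  rw [mem_Mn] at hf
  rw [mem_Tn] at hl
  unfold ind
  rw [if_neg]
  rintro ⟨h, -⟩
  have h1 := natDegree_le_of_dvd ((dvd_pow_self l.1 (by omega)).trans h) hf.1.ne_zero
  omega

lemma omega_eq {k n : ℕ} (hk : 2 ≤ k) {f : F[X]} (hf : f ∈ Mn F n) :
    (omegak F k f : ℝ) = ∑ l ∈ Tn F n, ind k l.1 f := by
  classical
  unfold ind
  rw [Finset.sum_boole]
  unfold omegak
  congr 1
  rw [← Nat.card_eq_finsetCard]
  refine Nat.card_congr (Equiv.ofBijective (fun l => ⟨⟨l.1, l.2.1, l.2.2.1⟩, ?_⟩) ⟨?_, ?_⟩)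
  · rw [Finset.mem_filter]
    refine ⟨?_, l.2.2.2⟩
    by_contra hl
    have := ind_zero hk hf hl
    unfold ind at this
    rw [if_pos l.2.2.2] at this
    exact one_ne_zero this
  · intro a b hab
    simp only [Subtype.mk.injEq] at hab
    exact Subtype.ext hab
  · rintro ⟨⟨l, h1, h2⟩, h⟩
    rw [Finset.mem_filter] at h
    exact ⟨⟨l, h1, h2, h.2⟩, rfl⟩

open Classical in
noncomputable def E2 (k n : ℕ) (p : PP F × PP F) : ℝ :=
  if p.1 = p.2 then 0 else ∑ f ∈ Mn F n, ind k p.1.1 f * ind k p.2.1 f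

lemma sum_omega_sq {k n : ℕ} (hk : 2 ≤ k) :
    ∑ f ∈ Mn F n, (omegak F k f : ℝ) ^ 2 =
      ∑ l ∈ Tn F n, ∑ f ∈ Mn F n, ind k l.1 f + ∑ p ∈ Tn F n ×ˢ Tn F n, E2 k n p := by
  classical
  have hind : ∀ (l f : F[X]), ind k l f * ind k l f = ind k l f := by
    intro l f; unfold ind; split_ifs <;> simp
  have h1 : ∑ f ∈ Mn F n, (omegak F k f : ℝ) ^ 2 =
      ∑ p ∈ Tn F n ×ˢ Tn F n, ∑ f ∈ Mn F n, ind k p.1.1 f * ind k p.2.1 f := by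
    rw [Finset.sum_comm]
    refine Finset.sum_congr rfl fun f hf => ?_
    rw [omega_eq hk hf, sq, Finset.sum_mul_sum, Finset.sum_product]
  have h2 : ∑ l ∈ Tn F n, ∑ f ∈ Mn F n, ind k l.1 f = ∑ p ∈ Tn F n ×ˢ Tn F n,
      if p.1 = p.2 then ∑ f ∈ Mn F n, ind k p.1.1 f * ind k p.2.1 f else 0 := by
    rw [Finset.sum_product]
    refine Finset.sum_congr rfl fun l hl => ?_
    simp only
    rw [Finset.sum_ite_eq, if_pos hl]
    simp_rw [hind]
  rw [h1, h2, ← Finset.sum_add_distrib]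
  refine Finset.sum_congr rfl fun p _ => ?_
  unfold E2
  split_ifs <;> simp


variable (F) in
lemma summable_L (m : ℕ) (hm : 2 ≤ m) :
    Summable (fun l : PP F => (((Fintype.card F : ℝ) ^ l.1.natDegree) ^ m)⁻¹) := by
  have hq := two_le_q (F := F)
  refine (sum_by_degree (fun l : PP F => l.1.natDegree) (fun d => (Fintype.card F : ℝ) ^ d)
    (fun d => (((Fintype.card F : ℝ) ^ d) ^ m)⁻¹) (fun d => by positivity) fiber1 ?_).1
  refine Summable.of_nonneg_of_le (fun d => by positivity) (fun d => ?_) summable_geometric_two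
  set q : ℝ := (Fintype.card F : ℝ)
  have hq0 : 0 < q := by linarith
  have h1 : (1 : ℝ) ≤ q ^ d := one_le_pow₀ (by linarith)
  calc q ^ d * ((q ^ d) ^ m)⁻¹ ≤ q ^ d * ((q ^ d) ^ 2)⁻¹ := by gcongr
    _ = (1 / q) ^ d := by rw [one_div, inv_pow]; field_simp
    _ ≤ (1 / 2) ^ d := by gcongr

lemma hasSum_del {k : ℕ} (hk : 2 ≤ k) :
    HasSum (del k : PP F → ℝ) (Lc F k - Lc F (k + 1)) :=
  (summable_L F k hk).hasSum.sub (summable_L F (k + 1) (by omega)).hasSum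

lemma hasSum_del_sq {k : ℕ} (hk : 2 ≤ k) :
    HasSum (fun l : PP F => del k l * del k l)
      (Lc F (2 * k) - 2 * Lc F (2 * k + 1) + Lc F (2 * k + 2)) := by
  have := ((summable_L F (2 * k) (by omega)).hasSum.sub
    ((summable_L F (2 * k + 1) (by omega)).hasSum.mul_left 2)).add
    (summable_L F (2 * k + 2) (by omega)).hasSum
  have h4 : (fun l : PP F => del k l * del k l) = fun l : PP F =>
      (((Fintype.card F : ℝ) ^ l.1.natDegree) ^ (2 * k))⁻¹ -
      2 * (((Fintype.card F : ℝ) ^ l.1.natDegree) ^ (2 * k + 1))⁻¹ +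
      (((Fintype.card F : ℝ) ^ l.1.natDegree) ^ (2 * k + 2))⁻¹ := by
    funext l
    unfold del
    ring
  rw [h4]
  exact this

open Classical in
noncomputable def D2 (k : ℕ) (p : PP F × PP F) : ℝ :=
  if p.1 = p.2 then 0 else del k p.1 * del k p.2

lemma hasSum_D2 {k : ℕ} (hk : 2 ≤ k) :
    HasSum (D2 k : PP F × PP F → ℝ) ((Lc F k - Lc F (k + 1)) * (Lc F k - Lc F (k + 1)) -
      (Lc F (2 * k) - 2 * Lc F (2 * k + 1) + Lc F (2 * k + 2))) := by
  classical
  have hd := hasSum_del (F := F) hk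
  have hs : Summable fun p : PP F × PP F => del k p.1 * del k p.2 :=
    summable_mul_of_summable_norm hd.summable.norm hd.summable.norm
  have h1 : HasSum (fun p : PP F × PP F => del k p.1 * del k p.2) _ := hd.mul hd hs
  have h2 : HasSum (fun p : PP F × PP F => if p.1 = p.2 then del k p.1 * del k p.2 else 0)
      (Lc F (2 * k) - 2 * Lc F (2 * k + 1) + Lc F (2 * k + 2)) := by
    have hinj : Function.Injective (fun l : PP F => (l, l)) := fun a b h => (Prod.ext_iff.1 h).1
    refine (hinj.hasSum_iff ?_).1 ?_
    · rintro ⟨a, b⟩ hab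
      refine if_neg fun h => hab ⟨a, ?_⟩
      simp only at h
      rw [h]
    · convert hasSum_del_sq (F := F) hk using 2
      simp
  have h3 := h1.sub h2
  have h4 : (D2 k : PP F × PP F → ℝ) = fun p => del k p.1 * del k p.2 -
      if p.1 = p.2 then del k p.1 * del k p.2 else 0 := by
    funext p
    unfold D2
    split_ifs <;> simp
  rw [h4]
  exact h3

lemma tsum_E1 {k n : ℕ} (hk : 2 ≤ k) :
    HasSum (fun l : PP F => ∑ f ∈ Mn F n, ind k l.1 f) (∑ l ∈ Tn F n, ∑ f ∈ Mn F n, ind k l.1 f) :=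
  hasSum_sum_of_ne_finset_zero fun _ hl => Finset.sum_eq_zero fun _ hf => ind_zero hk hf hl

lemma tsum_E2 {k n : ℕ} (hk : 2 ≤ k) :
    HasSum (E2 k n : PP F × PP F → ℝ) (∑ p ∈ Tn F n ×ˢ Tn F n, E2 k n p) := by
  refine hasSum_sum_of_ne_finset_zero fun p hp => ?_
  unfold E2
  split_ifs
  · rfl
  · refine Finset.sum_eq_zero fun f hf => ?_
    rw [Finset.mem_product, not_and_or] at hp
    rcases hp with hp | hp <;> simp [ind_zero hk hf hp]

lemma eps_nonneg (k n s : ℕ) : 0 ≤ eps F k n s := by unfold eps; positivity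

lemma tot1 {k n : ℕ} (hk : 2 ≤ k) :
    |∑ l ∈ Tn F n, ∑ f ∈ Mn F n, ind k l.1 f -
      (Fintype.card F : ℝ) ^ n * (Lc F k - Lc F (k + 1))| ≤
    2 * (Keps * (((n / k : ℕ) : ℝ) + 1) * (Fintype.card F : ℝ) ^ (n / k)) := by
  have h := (tsum_E1 (F := F) (n := n) hk).sub
    ((hasSum_del (F := F) hk).mul_left ((Fintype.card F : ℝ) ^ n))
  have he := eps_sum (Fintype.card F : ℝ) two_le_q k hk n
  obtain ⟨hb, hb'⟩ := sum_by_degree (fun l : PP F => l.1.natDegree)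
    (fun d => ((d : ℝ) + 1) * (Fintype.card F : ℝ) ^ d)
    (eps F k n) (eps_nonneg k n) (fun d u hu => (fiber1 d u hu).trans (by
      have : (0:ℝ) ≤ d * (Fintype.card F : ℝ) ^ d := by positivity
      linarith)) he.1
  rw [← h.tsum_eq, ← Real.norm_eq_abs]
  refine (tsum_of_norm_bounded (hb.hasSum.mul_left 2) fun l => ?_).trans
    (mul_le_mul_of_nonneg_left (hb'.trans he.2) (by norm_num))
  exact err1 k n l

lemma tot2 {k n : ℕ} (hk : 2 ≤ k) :
    |∑ p ∈ Tn F n ×ˢ Tn F n, E2 k n p -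
      (Fintype.card F : ℝ) ^ n * ((Lc F k - Lc F (k + 1)) * (Lc F k - Lc F (k + 1)) -
      (Lc F (2 * k) - 2 * Lc F (2 * k + 1) + Lc F (2 * k + 2)))| ≤
    4 * (Keps * (((n / k : ℕ) : ℝ) + 1) * (Fintype.card F : ℝ) ^ (n / k)) := by
  have h := (tsum_E2 (F := F) (n := n) hk).sub
    ((hasSum_D2 (F := F) hk).mul_left ((Fintype.card F : ℝ) ^ n))
  have he := eps_sum (Fintype.card F : ℝ) two_le_q k hk n
  obtain ⟨hb, hb'⟩ := sum_by_degree (fun p : PP F × PP F => p.1.1.natDegree + p.2.1.natDegree)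
    (fun d => ((d : ℝ) + 1) * (Fintype.card F : ℝ) ^ d)
    (eps F k n) (eps_nonneg k n) fiber2 he.1
  rw [← h.tsum_eq, ← Real.norm_eq_abs]
  refine (tsum_of_norm_bounded (hb.hasSum.mul_left 4) fun p => ?_).trans
    (mul_le_mul_of_nonneg_left (hb'.trans he.2) (by norm_num))
  unfold E2 D2
  split_ifs with hp
  · simpa using eps_nonneg (F := F) k n _
  · exact err2 k n p.1 p.2 hp

end poly
end aux

/-- Second moment of ω_k, k ≥ 2, over monic polynomials of degree n. -/
theorem second_moment_omega_k (F : Type*) [Field F] [Fintype F] (k : ℕ) (hk : 2 ≤ k) :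
    (fun n : ℕ =>
        (∑ᶠ f ∈ {f : Polynomial F | f.Monic ∧ f.natDegree = n},
            (omegak F k f : ℝ) ^ 2) -
          ((Lc F k - Lc F (k + 1)) * (Lc F k - Lc F (k + 1) + 1) -
            Lc F (2 * k) + 2 * Lc F (2 * k + 1) - Lc F (2 * k + 2)) *
            (Fintype.card F : ℝ) ^ n)
      =O[atTop] (fun n : ℕ => (n : ℝ) * (Fintype.card F : ℝ) ^ ((n : ℝ) / k)) := by
  refine IsBigO.of_bound (12 * Keps) ?_
  filter_upwards [eventually_ge_atTop 1] with n hn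
  have hq := two_le_q (F := F)
  have h1 := tot1 (F := F) (n := n) hk
  have h2 := tot2 (F := F) (n := n) hk
  have hfin : ∑ᶠ f ∈ {f : Polynomial F | f.Monic ∧ f.natDegree = n}, (omegak F k f : ℝ) ^ 2 =
      ∑ f ∈ Mn F n, (omegak F k f : ℝ) ^ 2 := by
    rw [finsum_mem_eq_finite_toFinset_sum _ (finite_monic F n)]
    rfl
  simp only [Set.mem_ofPred_eq] at hfin ⊢
  rw [hfin, sum_omega_sq hk]
  have hpow : (Fintype.card F : ℝ) ^ (n / k) ≤ (Fintype.card F : ℝ) ^ ((n : ℝ) / k) := by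
    rw [← Real.rpow_natCast]
    exact Real.rpow_le_rpow_of_exponent_le (by linarith) Nat.cast_div_le
  have hm : ((n / k : ℕ) : ℝ) + 1 ≤ 2 * n := by
    have h : n / k ≤ n := Nat.div_le_self n k
    exact_mod_cast (by omega : n / k + 1 ≤ 2 * n)
  have hB : Keps * (((n / k : ℕ) : ℝ) + 1) * (Fintype.card F : ℝ) ^ (n / k) ≤
      Keps * (2 * n) * (Fintype.card F : ℝ) ^ ((n : ℝ) / k) := by
    have := Keps_nonneg
    gcongr
  have hrhs : ‖(n : ℝ) * (Fintype.card F : ℝ) ^ ((n : ℝ) / k)‖ =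
      (n : ℝ) * (Fintype.card F : ℝ) ^ ((n : ℝ) / k) := by
    rw [Real.norm_eq_abs, abs_of_nonneg (by positivity)]
  rw [hrhs, Real.norm_eq_abs]
  rw [abs_le] at *
  constructor <;> nlinarith [h1.1, h1.2, h2.1, h2.2]
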